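/- For every summable weighted graph (G,m) whose vertex set has at least two elements, the top of the spectrum of the normalised Laplacian satisfies 2·h̄(G,m) ≤ λ_top(Δ). -/

import Mathlib

open MeasureTheory

/-- A summable weighted graph on a vertex set `V`. -/
structure SummableWeightedGraph (V : Type*) where
  m : V → V → ℝ
  symm : ∀ u v, m u v = m v u
  nonneg : ∀ u v, 0 ≤ m u v
  loopless : ∀ v, m v v = 0
  summable : Summable fun p : V × V => m p.1 p.2
  noIsolated : ∀ v, 0 < ∑' u, m v u

namespace SummableWeightedGraph

variable {V : Type*} (G : SummableWeightedGraph V)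

/-- The weight of a vertex. -/
noncomputable def deg (v : V) : ℝ := ∑' u, G.m v u

/-- The weight of a set of vertices. -/
noncomputable def setWeight (S : Set V) : ℝ := ∑' v : S, G.deg v

/-- The weight of the boundary of a set of vertices. -/
noncomputable def boundaryWeight (S : Set V) : ℝ :=
  ∑' p : ↥S × ↥Sᶜ, G.m p.1 p.2

/-- The Cheeger constant. -/
noncomputable def cheegerConst : ℝ :=
  sInf { r : ℝ | ∃ S : Set V, S.Nonempty ∧ G.setWeight S ≤ G.setWeight Sᶜ ∧
    r = G.boundaryWeight S / G.setWeight S }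

/-- The weighted counting measure on vertices. -/
noncomputable def measure [MeasurableSpace V] : Measure V :=
  Measure.sum fun v => ENNReal.ofReal (G.deg v) • Measure.dirac v

/-- The normalised Laplacian, characterised by its pointwise formula. -/
def IsLaplacian [MeasurableSpace V]
    (L : Lp ℝ 2 G.measure →L[ℝ] Lp ℝ 2 G.measure) : Prop :=
  ∀ f : Lp ℝ 2 G.measure, ∀ᵐ v ∂G.measure,
    L f v = f v - (G.deg v)⁻¹ * ∑' u, G.m v u * f u

end SummableWeightedGraph

namespace SummableWeightedGraph

variable {V : Type*} (G : SummableWeightedGraph V)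

/-- Total weight `m(A,B)` of the edges joining `A` to `B`. -/
noncomputable def pairWeight (A B : Set V) : ℝ := ∑' q : ↥A × ↥B, G.m q.1 q.2

/-- The dual Cheeger ratio of a pair of disjoint nonempty sets of vertices. -/
noncomputable def dualCheegerRatio (A B : Set V) : ℝ :=
  2 * G.pairWeight A B / (G.setWeight A + G.setWeight B)

/-- The dual Cheeger constant. -/
noncomputable def dualCheegerConst : ℝ :=
  sSup { r : ℝ | ∃ A B : Set V, A.Nonempty ∧ B.Nonempty ∧ Disjoint A B ∧
    r = G.dualCheegerRatio A B }

end SummableWeightedGraph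


theorem aux_top {H : Type*} [NormedAddCommGroup H] [InnerProductSpace ℝ H] [CompleteSpace H]
    (T : H →L[ℝ] H) (hT : ∀ x y, inner ℝ (T x) y = inner ℝ x (T y)) (f : H) (hf : f ≠ 0) :
    inner ℝ (T f) f ≤ sSup (spectrum ℝ T) * ‖f‖ ^ 2 := by
  set s : Set ℝ := {r | ∃ x : H, ‖x‖ = 1 ∧ r = inner ℝ (T x) x} with hs
  have hn : 0 < ‖f‖ := norm_pos_iff.2 hf
  have hmem : ∀ g : H, g ≠ 0 → inner ℝ (T g) g / ‖g‖ ^ 2 ∈ s := by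
    intro g hg
    have hg' : ‖g‖ ≠ 0 := norm_ne_zero_iff.2 hg
    refine ⟨‖g‖⁻¹ • g, ?_, ?_⟩
    · rw [norm_smul, norm_inv, norm_norm, inv_mul_cancel₀ hg']
    · rw [map_smul, real_inner_smul_left, real_inner_smul_right]
      field_simp
  have hbdd : BddAbove s := by
    refine ⟨‖T‖, ?_⟩
    rintro r ⟨x, hx, rfl⟩
    calc inner ℝ (T x) x ≤ ‖T x‖ * ‖x‖ := real_inner_le_norm _ _
      _ ≤ ‖T‖ * ‖x‖ * ‖x‖ := by gcongr; exact T.le_opNorm x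
      _ = ‖T‖ := by rw [hx]; ring
  set M := sSup s with hM
  have hle : ∀ g : H, inner ℝ (T g) g ≤ M * ‖g‖ ^ 2 := by
    intro g
    by_cases hg : g = 0
    · simp [hg]
    · have h1 := le_csSup hbdd (hmem g hg)
      have : 0 < ‖g‖ := norm_pos_iff.2 hg
      rwa [div_le_iff₀ (by positivity)] at h1
  have key : M ∈ spectrum ℝ T := by
    intro hu
    obtain ⟨u, hu⟩ := hu
    set S : H →L[ℝ] H := algebraMap ℝ (H →L[ℝ] H) M - T with hS
    have hSx : ∀ x, S x = M • x - T x := by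
      intro x; simp [hS, Algebra.algebraMap_eq_smul_one]
    have hSs : ∀ x y, inner ℝ (S x) y = inner ℝ x (S y) := by
      intro x y
      simp only [hSx, inner_sub_left, inner_sub_right, hT, real_inner_smul_left,
        real_inner_smul_right]
    have hSi : ∀ x, inner ℝ (S x) x = M * ‖x‖ ^ 2 - inner ℝ (T x) x := by
      intro x
      rw [hSx, inner_sub_left, real_inner_smul_left, real_inner_self_eq_norm_sq]
    have hSp : ∀ x, 0 ≤ inner ℝ (S x) x := by
      intro x; rw [hSi]; linarith [hle x]
    set c := ‖S‖ + 1 with hc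
    have hc0 : 0 < c := by positivity
    have hcs : ∀ x, ‖S x‖ ^ 2 ≤ c * inner ℝ (S x) x := by
      intro x
      have h := hSp (x - c⁻¹ • S x)
      have h2 : inner ℝ (S (S x)) (S x) ≤ c * ‖S x‖ ^ 2 := by
        calc _ ≤ ‖S (S x)‖ * ‖S x‖ := real_inner_le_norm _ _
          _ ≤ (‖S‖ * ‖S x‖) * ‖S x‖ := by gcongr; exact S.le_opNorm _
          _ ≤ c * ‖S x‖ ^ 2 := by nlinarith [sq_nonneg ‖S x‖]
      rw [map_sub, map_smul, inner_sub_left, inner_sub_right, inner_sub_right,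
        real_inner_smul_left, real_inner_smul_left, real_inner_smul_right,
        real_inner_smul_right, hSs (S x) x, real_inner_self_eq_norm_sq] at h
      have h3 : c⁻¹ * (c⁻¹ * inner ℝ (S (S x)) (S x)) ≤ c⁻¹ * ‖S x‖ ^ 2 := by
        have : c⁻¹ * inner ℝ (S (S x)) (S x) ≤ ‖S x‖ ^ 2 := by
          rw [inv_mul_le_iff₀ hc0]; exact h2
        gcongr
      have h4 : c⁻¹ * ‖S x‖ ^ 2 ≤ inner ℝ (S x) x := by linarith
      rwa [inv_mul_le_iff₀ hc0] at h4
    set R : H →L[ℝ] H := ((u⁻¹ : (H →L[ℝ] H)ˣ) : H →L[ℝ] H) with hR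
    have hRS : ∀ x, R (S x) = x := by
      intro x
      have : R * S = 1 := by rw [← hu]; simp [hR]
      simpa using congrArg (fun L : H →L[ℝ] H => L x) this
    set d := (‖R‖ ^ 2 + 1) * c with hd
    have hd0 : 0 < d := by positivity
    have hub : ∀ r ∈ s, r ≤ M - d⁻¹ := by
      rintro r ⟨x, hx, rfl⟩
      have h1 : 1 ≤ ‖R‖ * ‖S x‖ := by
        rw [← hx]
        calc ‖x‖ = ‖R (S x)‖ := by rw [hRS]
          _ ≤ _ := R.le_opNorm _
      have h2 : 1 ≤ ‖R‖ ^ 2 * ‖S x‖ ^ 2 := by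
        rw [← mul_pow]; exact one_le_pow₀ h1
      have h3 := hcs x
      have h4 : 1 ≤ d * inner ℝ (S x) x := by
        have : ‖R‖ ^ 2 * ‖S x‖ ^ 2 ≤ (‖R‖ ^ 2 + 1) * (c * inner ℝ (S x) x) := by
          gcongr; linarith
        rw [hd, mul_assoc]; linarith
      have h5 : d⁻¹ ≤ inner ℝ (S x) x := by
        rw [inv_le_iff_one_le_mul₀' hd0]; exact h4
      rw [hSi, hx] at h5
      linarith
    have := csSup_le ⟨_, hmem f hf⟩ hub
    have : 0 < d⁻¹ := by positivity
    linarith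
  have hb : BddAbove (spectrum ℝ T) := (spectrum.isBounded T).bddAbove
  have := le_csSup hb key
  calc _ ≤ M * ‖f‖ ^ 2 := hle f
    _ ≤ _ := by gcongr

namespace SummableWeightedGraph

variable {V : Type*} (G : SummableWeightedGraph V)

theorem aux_congr {ι : Type*} {f g : ι → ℝ} {a : ℝ} (h : HasSum f a) (e : ∀ i, g i = f i) :
    HasSum g a := by
  have : g = f := funext e
  rw [this]
  exact h

theorem aux_deg_pos (v : V) : 0 < G.deg v := G.noIsolated v

theorem aux_row (v : V) : Summable (fun u => G.m v u) :=
  G.summable.prod_factor v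

theorem aux_deg_summable : Summable G.deg := G.summable.prod

theorem aux_ae [MeasurableSpace V] [MeasurableSingletonClass V] [Countable V] {p : V → Prop}
    (h : ∀ᵐ v ∂G.measure, p v) (v : V) : p v := by
  rw [measure, Measure.ae_sum_iff] at h
  have h1 := h v
  have h0 : ENNReal.ofReal (G.deg v) ≠ 0 := by
    simpa using G.aux_deg_pos v
  rw [Measure.ae_ennreal_smul_measure_iff h0, ae_dirac_eq] at h1
  exact h1

theorem aux_finite [MeasurableSpace V] : IsFiniteMeasure G.measure := by
  refine ⟨?_⟩
  rw [measure, Measure.sum_apply _ MeasurableSet.univ]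
  simp only [Measure.smul_apply, measure_univ, smul_eq_mul, mul_one]
  rw [← ENNReal.ofReal_tsum_of_nonneg (fun v => (G.aux_deg_pos v).le) G.aux_deg_summable]
  exact ENNReal.ofReal_lt_top

theorem aux_hasSum [MeasurableSpace V] [MeasurableSingletonClass V] {f : V → ℝ}
    (hf : Integrable f G.measure) :
    HasSum (fun v => G.deg v * f v) (∫ v, f v ∂G.measure) := by
  have := hasSum_integral_measure (f := f)
    (μ := fun v => ENNReal.ofReal (G.deg v) • Measure.dirac v) hf
  have e : (fun v => ∫ a, f a ∂(ENNReal.ofReal (G.deg v) • Measure.dirac v))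
      = fun v => G.deg v * f v := by
    funext v
    simp [integral_smul_measure, ENNReal.toReal_ofReal (G.aux_deg_pos _).le]
  rw [e] at this
  exact this

theorem aux_inner [MeasurableSpace V] [MeasurableSingletonClass V]
    (f g : Lp ℝ 2 G.measure) :
    HasSum (fun v => G.deg v * (f v * g v)) (inner ℝ f g) := by
  have h := G.aux_hasSum (L2.integrable_inner (𝕜 := ℝ) f g)
  rw [← L2.inner_def] at h
  simpa [mul_comm] using h

/-- square summability on edges -/
theorem aux_sq (f : V → ℝ) (hf : Summable fun v => G.deg v * (f v * f v)) :
    Summable (fun p : V × V => G.m p.1 p.2 * (f p.1 * f p.1)) := by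
  have h0 : 0 ≤ (fun p : V × V => G.m p.1 p.2 * (f p.1 * f p.1)) := by
    intro p
    exact mul_nonneg (G.nonneg _ _) (mul_self_nonneg _)
  have e : ∀ v, ∑' u, G.m v u * (f v * f v) = G.deg v * (f v * f v) := by
    intro v
    rw [tsum_mul_right, deg]
  have h1 : ∀ v, Summable fun u => G.m v u * (f v * f v) := fun v =>
    (G.aux_row v).mul_right (f v * f v)
  have h2 : Summable fun v => ∑' u, G.m v u * (f v * f v) := by
    rw [funext e]
    exact hf
  exact (summable_prod_of_nonneg h0).2 ⟨h1, h2⟩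

theorem aux_sq_tsum (f : V → ℝ) (hf : Summable fun v => G.deg v * (f v * f v)) :
    ∑' p : V × V, G.m p.1 p.2 * (f p.1 * f p.1) = ∑' v, G.deg v * (f v * f v) := by
  rw [(G.aux_sq f hf).tsum_prod]
  simp only [tsum_mul_right]
  rfl

theorem aux_cross (f g : V → ℝ) (hf : Summable fun v => G.deg v * (f v * f v))
    (hg : Summable fun v => G.deg v * (g v * g v)) :
    Summable (fun p : V × V => G.m p.1 p.2 * (f p.2 * g p.1)) := by
  have h1 := G.aux_sq g hg
  have h2 : Summable (fun p : V × V => G.m p.1 p.2 * (f p.2 * f p.2)) := by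
    have := (G.aux_sq f hf).comp_injective (Equiv.prodComm V V).injective
    refine this.congr fun p => ?_
    simp [G.symm p.2 p.1]
  refine Summable.of_norm_bounded (h1.add h2) fun p => ?_
  rw [Real.norm_eq_abs, abs_mul, abs_of_nonneg (G.nonneg _ _), ← mul_add]
  refine mul_le_mul_of_nonneg_left ?_ (G.nonneg _ _)
  rw [abs_le]
  constructor <;> nlinarith [sq_nonneg (f p.2 - g p.1), sq_nonneg (f p.2 + g p.1)]

theorem aux_lap [MeasurableSpace V] [MeasurableSingletonClass V] [Countable V]
    (Δ : Lp ℝ 2 G.measure →L[ℝ] Lp ℝ 2 G.measure) (hΔ : G.IsLaplacian Δ)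
    (f g : Lp ℝ 2 G.measure) :
    inner ℝ (Δ f) g = inner ℝ f g - ∑' p : V × V, G.m p.1 p.2 * (f p.2 * g p.1) := by
  have hc := G.aux_cross f g (G.aux_inner f f).summable (G.aux_inner g g).summable
  have h1 := (G.aux_inner f g).sub (hc.prod.hasSum)
  rw [← hc.tsum_prod] at h1
  refine (G.aux_inner (Δ f) g).unique ?_
  refine aux_congr h1 fun v => ?_
  rw [G.aux_ae (hΔ f) v]
  have h2 : ∑' u, G.m v u * (f u * g v) = (∑' u, G.m v u * f u) * g v := by
    rw [← tsum_mul_right]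
    simp only [mul_assoc]
  have := (G.aux_deg_pos v).ne'
  simp only [h2]
  field_simp

theorem aux_symm [MeasurableSpace V] [MeasurableSingletonClass V] [Countable V]
    (Δ : Lp ℝ 2 G.measure →L[ℝ] Lp ℝ 2 G.measure) (hΔ : G.IsLaplacian Δ)
    (f g : Lp ℝ 2 G.measure) :
    inner ℝ (Δ f) g = inner ℝ f (Δ g) := by
  rw [real_inner_comm (Δ g) f, G.aux_lap Δ hΔ, G.aux_lap Δ hΔ, real_inner_comm]
  congr 1
  rw [← (Equiv.prodComm V V).tsum_eq]
  refine tsum_congr fun p => ?_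
  simp [G.symm p.2 p.1, mul_comm]

open Classical in
theorem aux_pair (A B : Set V) :
    HasSum (fun p : V × V => if p.1 ∈ A ∧ p.2 ∈ B then G.m p.1 p.2 else 0)
      (G.pairWeight A B) := by
  have h : G.pairWeight A B = ∑' p : ↥(A ×ˢ B), G.m p.1.1 p.1.2 := by
    rw [pairWeight, ← (Equiv.Set.prod A B).tsum_eq]
    rfl
  rw [h, tsum_subtype (A ×ˢ B) (fun p : V × V => G.m p.1 p.2)]
  have := (G.summable.indicator (A ×ˢ B)).hasSum
  refine aux_congr this fun p => ?_
  simp [Set.indicator_apply]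

theorem aux_pair_comm (A B : Set V) : G.pairWeight A B = G.pairWeight B A := by
  rw [pairWeight, pairWeight, ← (Equiv.prodComm _ _).tsum_eq]
  refine tsum_congr fun p => ?_
  simp [G.symm p.2 p.1]

open Classical in
theorem aux_set (A : Set V) :
    HasSum (fun v => if v ∈ A then G.deg v else 0) (G.setWeight A) := by
  rw [setWeight, tsum_subtype A G.deg]
  have := (G.aux_deg_summable.indicator A).hasSum
  refine aux_congr this fun p => ?_
  simp [Set.indicator_apply]

theorem aux_set_pos (A : Set V) (hA : A.Nonempty) : 0 < G.setWeight A := by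
  obtain ⟨a, ha⟩ := hA
  have : Summable (fun v : A => G.deg v) := G.aux_deg_summable.subtype A
  exact this.tsum_pos (fun v => (G.aux_deg_pos v).le) ⟨a, ha⟩ (G.aux_deg_pos a)

open Classical in
theorem aux_pt (A B : Set V) (hd : ∀ v, v ∈ A → v ∉ B) (w : ℝ) (hw : 0 ≤ w) (x y : V) :
    2 * ((if x ∈ A ∧ y ∈ B then w else 0) + (if x ∈ B ∧ y ∈ A then w else 0)) ≤
      w * ((if x ∈ A then (1 : ℝ) else if x ∈ B then -1 else 0) *
        (if x ∈ A then (1 : ℝ) else if x ∈ B then -1 else 0)) -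
      w * ((if y ∈ A then (1 : ℝ) else if y ∈ B then -1 else 0) *
        (if x ∈ A then (1 : ℝ) else if x ∈ B then -1 else 0)) := by
  have h1 := hd x
  have h2 := hd y
  by_cases hx : x ∈ A <;> by_cases hy : y ∈ A <;> by_cases hx' : x ∈ B <;>
    by_cases hy' : y ∈ B <;> simp_all <;> linarith

open Classical in
theorem aux_ratio [MeasurableSpace V] [MeasurableSingletonClass V] [Countable V]
    (Δ : Lp ℝ 2 G.measure →L[ℝ] Lp ℝ 2 G.measure) (hΔ : G.IsLaplacian Δ)
    (A B : Set V) (hA : A.Nonempty) (hB : B.Nonempty) (hAB : Disjoint A B) :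
    2 * G.dualCheegerRatio A B ≤ sSup (spectrum ℝ Δ) := by
  have := G.aux_finite
  have hd : ∀ v, v ∈ A → v ∉ B := fun v ha hb => Set.disjoint_left.1 hAB ha hb
  set φ : V → ℝ := fun v => if v ∈ A then 1 else if v ∈ B then -1 else 0 with hφ
  have hmem : MemLp φ 2 G.measure := by
    refine MemLp.of_bound (measurable_of_countable φ).aestronglyMeasurable 1
      (Filter.Eventually.of_forall fun v => ?_)
    simp only [hφ]
    split_ifs <;> simp
  set f : Lp ℝ 2 G.measure := hmem.toLp φ with hf
  have hfφ : ∀ v, f v = φ v := G.aux_ae hmem.coeFn_toLp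
  have hin := G.aux_inner f f
  have hnorm : inner ℝ f f = G.setWeight A + G.setWeight B := by
    refine hin.unique ?_
    refine aux_congr ((G.aux_set A).add (G.aux_set B)) fun v => ?_
    rw [hfφ]
    simp only [hφ]
    have := hd v
    split_ifs <;> simp_all
  have hpos : 0 < G.setWeight A + G.setWeight B :=
    add_pos (G.aux_set_pos A hA) (G.aux_set_pos B hB)
  have hf0 : f ≠ 0 := by
    intro h
    rw [h, inner_zero_left] at hnorm
    linarith
  have htop := aux_top Δ (G.aux_symm Δ hΔ) f hf0
  rw [← real_inner_self_eq_norm_sq, hnorm] at htop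
  have hlow : 4 * G.pairWeight A B ≤ inner ℝ (Δ f) f := by
    rw [G.aux_lap Δ hΔ, ← hin.tsum_eq, ← G.aux_sq_tsum f hin.summable]
    have hs := ((G.aux_sq f hin.summable).hasSum).sub
      ((G.aux_cross f f hin.summable hin.summable).hasSum)
    have hp := ((G.aux_pair A B).add (G.aux_pair B A)).mul_left 2
    have hpt : ∀ p : V × V, 2 * ((if p.1 ∈ A ∧ p.2 ∈ B then G.m p.1 p.2 else 0) +
        (if p.1 ∈ B ∧ p.2 ∈ A then G.m p.1 p.2 else 0)) ≤
        G.m p.1 p.2 * (f p.1 * f p.1) - G.m p.1 p.2 * (f p.2 * f p.1) := by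
      intro p
      rw [hfφ, hfφ]
      exact aux_pt A B hd (G.m p.1 p.2) (G.nonneg _ _) p.1 p.2
    have hfin := hasSum_le hpt hp hs
    rw [G.aux_pair_comm B A] at hfin
    linarith
  rw [dualCheegerRatio, ← mul_div_assoc, div_le_iff₀ hpos]
  linarith

end SummableWeightedGraph

open SummableWeightedGraph in
/-- `2·h̄(G,m) ≤ λ_top(Δ)`. -/
theorem dualCheeger_lower_bound_for_top {V : Type*} [MeasurableSpace V]
    [MeasurableSingletonClass V] [Countable V] [Nontrivial V] (G : SummableWeightedGraph V)
    (Δ : Lp ℝ 2 G.measure →L[ℝ] Lp ℝ 2 G.measure) (hΔ : G.IsLaplacian Δ) :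
    2 * G.dualCheegerConst ≤ sSup (spectrum ℝ Δ) := by
  have h : G.dualCheegerConst ≤ sSup (spectrum ℝ Δ) / 2 := by
    refine csSup_le ?_ ?_
    · obtain ⟨a, b, hab⟩ := exists_pair_ne V
      exact ⟨_, {a}, {b}, Set.singleton_nonempty a, Set.singleton_nonempty b,
        by simpa using hab, rfl⟩
    · rintro r ⟨A, B, hA, hB, hAB, rfl⟩
      linarith [G.aux_ratio Δ hΔ A B hA hB hAB]
  linarith
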